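/- arXiv:1412.0815 — 2 statements merged into one kernel-verified Lean document; each statement's English description precedes it below -/
import Mathlib

section
/- Let (b,c) be a connected graph over a countably infinite set X and let m be a measure on X of full support. Then the closure of C_c(X) with respect to the norm ‖·‖_Q = (Q(·) + ‖·‖_m²)^{1/2} equals D₀ ∩ ℓ²(X,m). -/
open ENNReal Filter Topology

namespace UTGraph

variable {X : Type*}

/-- A graph over `X`: symmetric nonnegative edge weight `b` with zero diagonal and
summable rows, together with a nonnegative potential (killing term) `c`. -/
structure IsGraph (b : X → X → ℝ) (c : X → ℝ) : Prop where
  symm : ∀ x y, b x y = b y x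
  nonneg : ∀ x y, 0 ≤ b x y
  loopless : ∀ x, b x x = 0
  row_summable : ∀ x, Summable fun y => b x y
  c_nonneg : ∀ x, 0 ≤ c x

/-- Connectedness: any two vertices are joined by a path of positive edge weights. -/
def Connected (b : X → X → ℝ) : Prop :=
  ∀ x y : X, Relation.ReflTransGen (fun u v => 0 < b u v) x y

/-- The energy form `Q(f)`, with values in `[0,∞]`. -/
noncomputable def energy (b : X → X → ℝ) (c : X → ℝ) (f : X → ℝ) : ℝ≥0∞ :=
  (1 / 2) * ∑' p : X × X, ENNReal.ofReal (b p.1 p.2 * (f p.1 - f p.2) ^ 2)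
    + ∑' x, ENNReal.ofReal (c x * f x ^ 2)

/-- `f` has finite energy, i.e. `f ∈ D`. -/
def FiniteEnergy (b : X → X → ℝ) (c : X → ℝ) (f : X → ℝ) : Prop :=
  energy b c f < ⊤

/-- The bilinear energy form `Q(f,g)` (for finite-energy functions). -/
noncomputable def energyBilin (b : X → X → ℝ) (c : X → ℝ) (f g : X → ℝ) : ℝ :=
  (1 / 2) * ∑' p : X × X, b p.1 p.2 * (f p.1 - f p.2) * (g p.1 - g p.2)
    + ∑' x, c x * f x * g x

/-- `f ∈ C_c(X)`: finitely supported function. -/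
def FinSupp (f : X → ℝ) : Prop := (Function.support f).Finite

/-- The norm `‖f‖_o = (Q(f) + f(o)²)^{1/2}`. -/
noncomputable def normO (b : X → X → ℝ) (c : X → ℝ) (o : X) (f : X → ℝ) : ℝ :=
  Real.sqrt ((energy b c f).toReal + f o ^ 2)

/-- `f ∈ D₀`: there is a sequence of finitely supported functions converging to `f`
pointwise whose energy difference to `f` tends to `0`. -/
def MemD0 (b : X → X → ℝ) (c : X → ℝ) (f : X → ℝ) : Prop :=
  ∃ φ : ℕ → X → ℝ, (∀ n, FinSupp (φ n)) ∧
    (∀ x, Tendsto (fun n => φ n x) atTop (𝓝 (f x))) ∧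
    Tendsto (fun n => energy b c (φ n - f)) atTop (𝓝 0)

/-- `f ∈ C₀(X)`: `f` belongs to the uniform closure of the finitely supported functions,
i.e. for every `ε > 0` the set where `|f| ≥ ε` is finite. -/
def MemC0 (f : X → ℝ) : Prop := ∀ ε : ℝ, 0 < ε → {x | ε ≤ |f x|}.Finite

/-- The graph is uniformly transient: `D₀ ⊆ C₀(X)`. -/
def UniformlyTransient (b : X → X → ℝ) (c : X → ℝ) : Prop :=
  ∀ f : X → ℝ, MemD0 b c f → MemC0 f

/-- The capacity of a point: `cap(x) = inf {Q(φ) : φ ∈ C_c(X), φ(x) = 1}`. -/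
noncomputable def cap (b : X → X → ℝ) (c : X → ℝ) (x : X) : ℝ≥0∞ :=
  ⨅ (φ : X → ℝ) (_ : FinSupp φ) (_ : φ x = 1), energy b c φ

/-- `f ∈ F`: the domain of the formal Laplacian. -/
def MemF (b : X → X → ℝ) (f : X → ℝ) : Prop :=
  ∀ x, Summable fun y => b x y * |f y|

/-- The formal Laplacian `𝓛 f (x) = Σ_y b(x,y)(f(x) - f(y)) + c(x) f(x)`. -/
noncomputable def formalLaplacian (b : X → X → ℝ) (c : X → ℝ) (f : X → ℝ) (x : X) : ℝ :=
  (∑' y, b x y * (f x - f y)) + c x * f x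

/-- `f` is harmonic: `f ∈ F` and `𝓛 f = 0`. -/
def Harmonic (b : X → X → ℝ) (c : X → ℝ) (f : X → ℝ) : Prop :=
  MemF b f ∧ ∀ x, formalLaplacian b c f x = 0

/-- The graph is recurrent: the constant function `1` lies in `D₀` and `Q(1) = 0`. -/
def Recurrent (b : X → X → ℝ) (c : X → ℝ) : Prop :=
  MemD0 b c 1 ∧ energy b c 1 = 0

/-- The graph is transient: not recurrent. -/
def Transient (b : X → X → ℝ) (c : X → ℝ) : Prop := ¬ Recurrent b c

/-- The metric `γ_o`. -/
noncomputable def gammaO (b : X → X → ℝ) (c : X → ℝ) (o x y : X) : ℝ :=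
  sSup {d : ℝ | ∃ φ : X → ℝ, FinSupp φ ∧
    energy b c φ + ENNReal.ofReal (φ o ^ 2) ≤ 1 ∧ d = |φ x - φ y|}

/-- The metric `γ`. -/
noncomputable def gamma (b : X → X → ℝ) (c : X → ℝ) (x y : X) : ℝ :=
  sSup {d : ℝ | ∃ φ : X → ℝ, FinSupp φ ∧ energy b c φ ≤ 1 ∧ d = |φ x - φ y|}

/-- `d` is a metric on `X`. -/
def IsMetric (d : X → X → ℝ) : Prop :=
  (∀ x y, 0 ≤ d x y) ∧ (∀ x y, d x y = d y x) ∧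
  (∀ x y, d x y = 0 ↔ x = y) ∧ (∀ x y z, d x z ≤ d x y + d y z)

/-- `f` belongs to the closure of `C_c(X)` with respect to the norm
`‖·‖_Q = (Q(·) + ‖·‖_m²)^{1/2}` inside `D ∩ ℓ²(X,m)`. -/
def MemFormDomain (b : X → X → ℝ) (c : X → ℝ) (m : X → ℝ) (f : X → ℝ) : Prop :=
  FiniteEnergy b c f ∧ Summable (fun x => m x * f x ^ 2) ∧
  ∃ φ : ℕ → X → ℝ, (∀ n, FinSupp (φ n)) ∧
    Tendsto (fun n => energy b c (f - φ n)
      + ∑' x, ENNReal.ofReal (m x * (f x - φ n x) ^ 2)) atTop (𝓝 0)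

end UTGraph

namespace UTGraph

variable {X : Type*} {b : X → X → ℝ} {c : X → ℝ}

/-- Dominated convergence to zero for sums in `[0,∞]`. -/
lemma tendsto_tsum_zero_of_dominated {ι : Type*} [Countable ι] {F : ℕ → ι → ℝ≥0∞} {B : ι → ℝ≥0∞}
    (hB : ∑' i, B i ≠ ⊤) (hle : ∀ n i, F n i ≤ B i)
    (hF : ∀ i, Tendsto (fun n => F n i) atTop (𝓝 0)) :
    Tendsto (fun n => ∑' i, F n i) atTop (𝓝 0) := by
  let _ : MeasurableSpace ι := ⊤
  have h := MeasureTheory.tendsto_lintegral_of_dominated_convergence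
    (μ := MeasureTheory.Measure.count) (F := F) (f := fun _ => 0) B
    (fun n => measurable_from_top) (fun n => Eventually.of_forall (hle n))
    (by rwa [MeasureTheory.lintegral_count]) (Eventually.of_forall hF)
  simpa [MeasureTheory.lintegral_count] using h

lemma energy_sub_comm (f g : X → ℝ) : energy b c (f - g) = energy b c (g - f) := by
  have hedge : ∀ p : X × X, ((f - g) p.1 - (f - g) p.2) ^ 2 = ((g - f) p.1 - (g - f) p.2) ^ 2 :=
    fun p => by
      simp only [Pi.sub_apply]
      ring
  have hpot : ∀ x, (f - g) x ^ 2 = (g - f) x ^ 2 := fun x => sub_sq_comm (f x) (g x)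
  unfold energy
  exact congrArg₂ (fun u v => 1 / 2 * u + v)
    (tsum_congr fun p => by rw [hedge]) (tsum_congr fun x => by rw [hpot])

lemma ofReal_mul_add_sq_le {a : ℝ} (ha : 0 ≤ a) (s t : ℝ) :
    ENNReal.ofReal (a * (s + t) ^ 2) ≤
      2 * ENNReal.ofReal (a * s ^ 2) + 2 * ENNReal.ofReal (a * t ^ 2) := by
  have h2 : (2 : ℝ≥0∞) = ENNReal.ofReal 2 := by simp
  rw [h2, ← ENNReal.ofReal_mul (by norm_num), ← ENNReal.ofReal_mul (by norm_num),
    ← ENNReal.ofReal_add (by positivity) (by positivity)]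
  exact ENNReal.ofReal_le_ofReal (by nlinarith [mul_nonneg ha (sq_nonneg (s - t))])

lemma energy_add_le (hgraph : IsGraph b c) (f g : X → ℝ) :
    energy b c (f + g) ≤ 2 * energy b c f + 2 * energy b c g := by
  have hedge : ∑' p : X × X, ENNReal.ofReal (b p.1 p.2 * ((f + g) p.1 - (f + g) p.2) ^ 2) ≤
      2 * ∑' p : X × X, ENNReal.ofReal (b p.1 p.2 * (f p.1 - f p.2) ^ 2) +
      2 * ∑' p : X × X, ENNReal.ofReal (b p.1 p.2 * (g p.1 - g p.2) ^ 2) := by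
    rw [← ENNReal.tsum_mul_left, ← ENNReal.tsum_mul_left, ← ENNReal.tsum_add]
    refine ENNReal.tsum_le_tsum fun p => ?_
    have h := ofReal_mul_add_sq_le (hgraph.nonneg p.1 p.2) (f p.1 - f p.2) (g p.1 - g p.2)
    rwa [sub_add_sub_comm] at h
  have hpot : ∑' x, ENNReal.ofReal (c x * (f + g) x ^ 2) ≤
      2 * ∑' x, ENNReal.ofReal (c x * f x ^ 2) + 2 * ∑' x, ENNReal.ofReal (c x * g x ^ 2) := by
    rw [← ENNReal.tsum_mul_left, ← ENNReal.tsum_mul_left, ← ENNReal.tsum_add]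
    exact ENNReal.tsum_le_tsum fun x => ofReal_mul_add_sq_le (hgraph.c_nonneg x) (f x) (g x)
  unfold energy
  refine (add_le_add (mul_le_mul_right hedge (1 / 2)) hpot).trans_eq ?_
  ring

lemma tsum_ofReal_ne_top_of_finSupp {φ : X → ℝ} (hφ : FinSupp φ) (d : X → ℝ) :
    ∑' x, ENNReal.ofReal (d x * φ x ^ 2) ≠ ⊤ := by
  rw [tsum_eq_sum (s := hφ.toFinset)]
  · exact ENNReal.sum_ne_top.2 fun _ _ => ENNReal.ofReal_ne_top
  · intro x hx
    have : φ x = 0 := by simpa using mt hφ.mem_toFinset.2 hx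
    simp [this]

lemma finiteEnergy_of_finSupp (hgraph : IsGraph b c) {φ : X → ℝ} (hφ : FinSupp φ) :
    FiniteEnergy b c φ := by
  have hrow : ∑' p : X × X, ENNReal.ofReal (b p.1 p.2 * φ p.1 ^ 2) ≠ ⊤ := by
    rw [ENNReal.tsum_prod']
    have h : ∀ x, ∑' y, ENNReal.ofReal (b x y * φ x ^ 2) =
        ENNReal.ofReal ((∑' y, b x y) * φ x ^ 2) := fun x => by
      rw [← tsum_mul_right, ENNReal.ofReal_tsum_of_nonneg
        (fun y => mul_nonneg (hgraph.nonneg x y) (sq_nonneg _))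
        ((hgraph.row_summable x).mul_right _)]
    simp only [h]
    exact tsum_ofReal_ne_top_of_finSupp hφ _
  have hcol : ∑' p : X × X, ENNReal.ofReal (b p.1 p.2 * φ p.2 ^ 2) ≠ ⊤ := by
    rw [← (Equiv.prodComm X X).tsum_eq]
    simpa only [Equiv.prodComm_apply, Prod.fst_swap, Prod.snd_swap,
      fun p : X × X => hgraph.symm p.2 p.1] using hrow
  have hedge : ∑' p : X × X, ENNReal.ofReal (b p.1 p.2 * (φ p.1 - φ p.2) ^ 2) ≠ ⊤ := by
    have hle := ENNReal.tsum_le_tsum fun p : X × X =>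
      ofReal_mul_add_sq_le (hgraph.nonneg p.1 p.2) (φ p.1) (-φ p.2)
    simp only [← sub_eq_add_neg, neg_sq] at hle
    rw [ENNReal.tsum_add, ENNReal.tsum_mul_left, ENNReal.tsum_mul_left] at hle
    exact ne_top_of_le_ne_top (ENNReal.add_ne_top.2
      ⟨ENNReal.mul_ne_top (by simp) hrow, ENNReal.mul_ne_top (by simp) hcol⟩) hle
  exact ENNReal.add_lt_top.2 ⟨ENNReal.mul_lt_top (by simp) hedge.lt_top,
    (tsum_ofReal_ne_top_of_finSupp hφ c).lt_top⟩

lemma MemD0.finiteEnergy (hgraph : IsGraph b c) {f : X → ℝ} (hf : MemD0 b c f) :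
    FiniteEnergy b c f := by
  obtain ⟨φ, hφ, -, hE⟩ := hf
  obtain ⟨n, hn⟩ := (hE.eventually (gt_mem_nhds ENNReal.zero_lt_top)).exists
  have h := energy_add_le hgraph (f - φ n) (φ n)
  rw [sub_add_cancel, energy_sub_comm] at h
  exact h.trans_lt (ENNReal.add_lt_top.2 ⟨ENNReal.mul_lt_top (by simp) hn,
    ENNReal.mul_lt_top (by simp) (finiteEnergy_of_finSupp hgraph (hφ n))⟩)

/-- The value `s` clipped to the interval between `0` and `t`. -/
noncomputable def clip (s t : ℝ) : ℝ := max (min s (max t 0)) (min t 0)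

lemma clip_self (t : ℝ) : clip t t = t := by
  unfold clip
  grind

lemma abs_clip_le_left (s t : ℝ) : |clip s t| ≤ |s| := by
  unfold clip
  grind

lemma abs_clip_le_right (s t : ℝ) : |clip s t| ≤ |t| := by
  unfold clip
  grind

lemma abs_clip_sub_clip_le (s t s' t' : ℝ) :
    |clip s t - clip s' t'| ≤ max |s - s'| |t - t'| := by
  have hmax : |max t 0 - max t' 0| ≤ |t - t'| := by
    simpa using abs_max_sub_max_le_max t 0 t' 0
  have hmin : |min t 0 - min t' 0| ≤ |t - t'| := by
    simpa using abs_min_sub_min_le_max t 0 t' 0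
  refine (abs_max_sub_max_le_max _ _ _ _).trans (max_le ?_ (hmin.trans (le_max_right _ _)))
  exact (abs_min_sub_min_le_max _ _ _ _).trans (max_le_max le_rfl hmax)

lemma ofReal_mul_clip_sub_clip_sq_le {a : ℝ} (ha : 0 ≤ a) (s t s' t' : ℝ) :
    ENNReal.ofReal (a * (clip s t - clip s' t') ^ 2) ≤ ENNReal.ofReal (a * (s - s') ^ 2) +
      min (ENNReal.ofReal (a * (clip s t - clip s' t') ^ 2))
        (ENNReal.ofReal (a * (t - t') ^ 2)) := by
  rcases le_max_iff.1 (abs_clip_sub_clip_le s t s' t') with h | h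
  · exact le_add_right
      (ENNReal.ofReal_le_ofReal (mul_le_mul_of_nonneg_left (sq_le_sq.2 h) ha))
  · rw [min_eq_left (ENNReal.ofReal_le_ofReal (mul_le_mul_of_nonneg_left (sq_le_sq.2 h) ha))]
    exact le_add_self

lemma tendsto_ofReal_mul_sq {u : ℕ → ℝ} (hu : Tendsto u atTop (𝓝 0)) (a : ℝ) :
    Tendsto (fun n => ENNReal.ofReal (a * u n ^ 2)) atTop (𝓝 0) := by
  simpa using ENNReal.tendsto_ofReal ((hu.pow 2).const_mul a)

/-- Clipping a sequence that tends to zero pointwise and in energy by a function of finite energy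
preserves convergence to zero in energy. -/
lemma tendsto_energy_clip [Countable X] (hgraph : IsGraph b c) {f : X → ℝ}
    (hf : FiniteEnergy b c f) {g : ℕ → X → ℝ}
    (hg : ∀ x, Tendsto (fun n => clip (g n x) (f x)) atTop (𝓝 0))
    (hE : Tendsto (fun n => energy b c (g n)) atTop (𝓝 0)) :
    Tendsto (fun n => energy b c (fun x => clip (g n x) (f x))) atTop (𝓝 0) := by
  have hfin : ∑' p : X × X, ENNReal.ofReal (b p.1 p.2 * (f p.1 - f p.2) ^ 2) ≠ ⊤ := by
    intro h
    simp [FiniteEnergy, energy, h] at hf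
  have hdom : Tendsto (fun n => ∑' p : X × X,
      min (ENNReal.ofReal (b p.1 p.2 * (clip (g n p.1) (f p.1) - clip (g n p.2) (f p.2)) ^ 2))
        (ENNReal.ofReal (b p.1 p.2 * (f p.1 - f p.2) ^ 2))) atTop (𝓝 0) := by
    refine tendsto_tsum_zero_of_dominated hfin (fun n p => min_le_right _ _) fun p => ?_
    refine tendsto_of_tendsto_of_tendsto_of_le_of_le tendsto_const_nhds
      (tendsto_ofReal_mul_sq ?_ (b p.1 p.2)) (fun _ => zero_le) (fun _ => min_le_left _ _)
    simpa using (hg p.1).sub (hg p.2)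
  have hbound := hE.add (ENNReal.Tendsto.const_mul (a := 1 / 2) hdom (Or.inr (by simp)))
  rw [mul_zero, add_zero] at hbound
  refine tendsto_of_tendsto_of_tendsto_of_le_of_le tendsto_const_nhds hbound
    (fun _ => zero_le) fun n => ?_
  have hedge := ENNReal.tsum_le_tsum fun p : X × X => ofReal_mul_clip_sub_clip_sq_le
    (hgraph.nonneg p.1 p.2) (g n p.1) (f p.1) (g n p.2) (f p.2)
  rw [ENNReal.tsum_add] at hedge
  have hpot : ∑' x, ENNReal.ofReal (c x * clip (g n x) (f x) ^ 2) ≤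
      ∑' x, ENNReal.ofReal (c x * g n x ^ 2) :=
    ENNReal.tsum_le_tsum fun x => ENNReal.ofReal_le_ofReal
      (mul_le_mul_of_nonneg_left (sq_le_sq.2 (abs_clip_le_left _ _)) (hgraph.c_nonneg x))
  refine (add_le_add (mul_le_mul_right hedge (1 / 2)) hpot).trans_eq ?_
  unfold energy
  ring

lemma MemFormDomain.memD0 {m : X → ℝ} (hm : ∀ x, 0 < m x) {f : X → ℝ}
    (hf : MemFormDomain b c m f) : MemD0 b c f := by
  obtain ⟨-, -, φ, hφ, h⟩ := hf
  refine ⟨φ, hφ, fun x => ?_, ?_⟩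
  · have h1 : Tendsto (fun n => ENNReal.ofReal (m x * (f x - φ n x) ^ 2)) atTop (𝓝 0) :=
      tendsto_of_tendsto_of_tendsto_of_le_of_le tendsto_const_nhds h (fun _ => zero_le)
        fun n => (ENNReal.le_tsum x).trans le_add_self
    have h2 := (ENNReal.tendsto_toReal ENNReal.zero_ne_top).comp h1
    have h3 : Tendsto (fun n => (f x - φ n x) ^ 2) atTop (𝓝 0) := by
      have h4 := h2.const_mul (m x)⁻¹
      simp only [ENNReal.toReal_zero, mul_zero] at h4
      refine h4.congr fun n => ?_
      rw [Function.comp_apply, ENNReal.toReal_ofReal (mul_nonneg (hm x).le (sq_nonneg _)),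
        inv_mul_cancel_left₀ (hm x).ne']
    have h5 : Tendsto (fun n => |f x - φ n x|) atTop (𝓝 0) := by
      simpa [Real.sqrt_sq_eq_abs] using h3.sqrt
    simpa using ((tendsto_zero_iff_abs_tendsto_zero _).2 h5).const_sub (f x)
  · refine tendsto_of_tendsto_of_tendsto_of_le_of_le tendsto_const_nhds h (fun _ => zero_le)
      fun n => ?_
    rw [energy_sub_comm]
    exact le_self_add

lemma MemD0.memFormDomain [Countable X] (hgraph : IsGraph b c) {m : X → ℝ} (hm : ∀ x, 0 < m x)
    {f : X → ℝ} (hf : MemD0 b c f) (hsum : Summable fun x => m x * f x ^ 2) :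
    MemFormDomain b c m f := by
  have hfin := hf.finiteEnergy hgraph
  obtain ⟨φ, hφ, hpt, hE⟩ := hf
  have hclip : ∀ x, Tendsto (fun n => clip ((f - φ n) x) (f x)) atTop (𝓝 0) := fun x => by
    refine squeeze_zero_norm (fun n => abs_clip_le_left _ _) ?_
    simpa using ((hpt x).const_sub (f x)).abs
  refine ⟨hfin, hsum, fun n x => f x - clip ((f - φ n) x) (f x), fun n => ?_, ?_⟩
  · refine (hφ n).subset fun x hx => ?_
    contrapose! hx
    have h0 : φ n x = 0 := by simpa using hx
    simp [h0, clip_self]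
  · have hQ := tendsto_energy_clip hgraph hfin hclip (by simpa only [energy_sub_comm] using hE)
    have hm0 : Tendsto (fun n => ∑' x, ENNReal.ofReal (m x * clip ((f - φ n) x) (f x) ^ 2))
        atTop (𝓝 0) :=
      tendsto_tsum_zero_of_dominated hsum.tsum_ofReal_ne_top
        (fun n x => ENNReal.ofReal_le_ofReal
          (mul_le_mul_of_nonneg_left (sq_le_sq.2 (abs_clip_le_right _ _)) (hm x).le))
        fun x => tendsto_ofReal_mul_sq (hclip x) (m x)
    have h := hQ.add hm0
    rw [add_zero] at h
    refine h.congr fun n => ?_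
    have hsub : (f - fun x => f x - clip ((f - φ n) x) (f x)) =
        fun x => clip ((f - φ n) x) (f x) := by
      ext x
      simp
    simp only [hsub, _root_.sub_sub_cancel]

end UTGraph

open UTGraph Filter Topology ENNReal in
/-- the closure of `C_c(X)` with respect to `‖·‖_Q` equals
`D₀ ∩ ℓ²(X,m)`. -/
theorem stmt7 {X : Type*} [Countable X] [Infinite X]
    (b : X → X → ℝ) (c : X → ℝ) (hgraph : IsGraph b c) (hconn : Connected b)
    (m : X → ℝ) (hm : ∀ x, 0 < m x) :
    ∀ f : X → ℝ, MemFormDomain b c m f ↔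
      (MemD0 b c f ∧ Summable (fun x => m x * f x ^ 2)) := by
  exact fun f => ⟨fun hf => ⟨hf.memD0 hm, hf.2.1⟩, fun hf => hf.1.memFormDomain hgraph hm hf.2⟩
end

section
/- Let (b,c) be a connected graph over a countably infinite set X that is quasi-vertex-transitive and transient. Then (b,c) is uniformly transient, i.e. D₀ ⊆ C₀(X). -/
open ENNReal Filter Topology

namespace UTGraph

section Energy

variable {X : Type*} {b : X → X → ℝ} {c : X → ℝ}

theorem energy_smul (b : X → X → ℝ) (c : X → ℝ) (a : ℝ) (f : X → ℝ) :
    energy b c (a • f) = ENNReal.ofReal (a ^ 2) * energy b c f := by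
  have h₁ : ∀ p : X × X, ENNReal.ofReal (b p.1 p.2 * ((a • f) p.1 - (a • f) p.2) ^ 2)
      = ENNReal.ofReal (a ^ 2) * ENNReal.ofReal (b p.1 p.2 * (f p.1 - f p.2) ^ 2) := by
    intro p
    rw [← ENNReal.ofReal_mul (sq_nonneg a)]
    congr 1
    simp only [Pi.smul_apply, smul_eq_mul]
    ring
  have h₂ : ∀ x, ENNReal.ofReal (c x * (a • f) x ^ 2)
      = ENNReal.ofReal (a ^ 2) * ENNReal.ofReal (c x * f x ^ 2) := by
    intro x
    rw [← ENNReal.ofReal_mul (sq_nonneg a)]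
    congr 1
    simp only [Pi.smul_apply, smul_eq_mul]
    ring
  simp only [energy, h₁, h₂, ENNReal.tsum_mul_left]
  ring

theorem energy_sub_le (hg : IsGraph b c) (f g : X → ℝ) :
    energy b c (f - g) ≤ 2 * (energy b c f + energy b c g) := by
  have key : ∀ {k s t : ℝ}, 0 ≤ k → ENNReal.ofReal (k * (s - t) ^ 2)
      ≤ 2 * (ENNReal.ofReal (k * s ^ 2) + ENNReal.ofReal (k * t ^ 2)) := by
    intro k s t hk
    have h2 : (2 : ℝ≥0∞) = ENNReal.ofReal 2 := by simp
    rw [← ENNReal.ofReal_add (by positivity) (by positivity), h2,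
      ← ENNReal.ofReal_mul (by norm_num)]
    apply ENNReal.ofReal_le_ofReal
    nlinarith [mul_nonneg hk (sq_nonneg (s + t))]
  have h₁ : ∑' p : X × X, ENNReal.ofReal (b p.1 p.2 * ((f - g) p.1 - (f - g) p.2) ^ 2)
      ≤ 2 * (∑' p : X × X, ENNReal.ofReal (b p.1 p.2 * (f p.1 - f p.2) ^ 2)
        + ∑' p : X × X, ENNReal.ofReal (b p.1 p.2 * (g p.1 - g p.2) ^ 2)) := by
    rw [← ENNReal.tsum_add, ← ENNReal.tsum_mul_left]
    refine ENNReal.tsum_le_tsum fun p => ?_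
    rw [show (f - g) p.1 - (f - g) p.2 = (f p.1 - f p.2) - (g p.1 - g p.2) by
      simp only [Pi.sub_apply]; ring]
    exact key (hg.nonneg _ _)
  have h₂ : ∑' x, ENNReal.ofReal (c x * (f - g) x ^ 2)
      ≤ 2 * (∑' x, ENNReal.ofReal (c x * f x ^ 2) + ∑' x, ENNReal.ofReal (c x * g x ^ 2)) := by
    rw [← ENNReal.tsum_add, ← ENNReal.tsum_mul_left]
    exact ENNReal.tsum_le_tsum fun x => key (hg.c_nonneg x)
  unfold energy
  refine (add_le_add (mul_le_mul_right h₁ _) h₂).trans (le_of_eq ?_)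
  ring

/-- The energy is invariant under automorphisms of the graph. -/
theorem energy_comp_equiv (e : X ≃ X) (hc : ∀ z, c (e z) = c z)
    (hb : ∀ v w, b (e v) (e w) = b v w) (f : X → ℝ) :
    energy b c (f ∘ e) = energy b c f := by
  unfold energy
  rw [← (e.prodCongr e).tsum_eq (fun p : X × X =>
      ENNReal.ofReal (b p.1 p.2 * (f p.1 - f p.2) ^ 2)),
    ← e.tsum_eq (fun x => ENNReal.ofReal (c x * f x ^ 2))]
  simp [hc, hb]

theorem edge_le_energy (f : X → ℝ) (u v : X) :
    ENNReal.ofReal (b u v * (f u - f v) ^ 2) ≤ 2 * energy b c f := by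
  have h := ENNReal.le_tsum (f := fun p : X × X =>
    ENNReal.ofReal (b p.1 p.2 * (f p.1 - f p.2) ^ 2)) (u, v)
  refine h.trans ?_
  unfold energy
  rw [mul_add, ← mul_assoc, one_div, ENNReal.mul_inv_cancel (by simp) (by simp), one_mul]
  exact le_self_add

theorem potential_le_energy (f : X → ℝ) (x : X) :
    ENNReal.ofReal (c x * f x ^ 2) ≤ energy b c f :=
  (ENNReal.le_tsum (f := fun x => ENNReal.ofReal (c x * f x ^ 2)) x).trans le_add_self

theorem tendsto_zero_of_ofReal_le {u : ℕ → ℝ} {v : ℕ → ℝ≥0∞} (hu : ∀ n, 0 ≤ u n)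
    (huv : ∀ n, ENNReal.ofReal (u n) ≤ v n) (hv : Tendsto v atTop (𝓝 0)) :
    Tendsto u atTop (𝓝 0) := by
  have h := tendsto_of_tendsto_of_tendsto_of_le_of_le tendsto_const_nhds hv
    (fun n => zero_le) huv
  have h' := (ENNReal.tendsto_toReal ENNReal.zero_ne_top).comp h
  simpa [Function.comp_def, ENNReal.toReal_ofReal, hu] using h'

/-- A sequence of functions with vanishing energy that is normalized at one vertex converges
pointwise to the constant function `1` on a connected graph. -/
theorem tendsto_one_of_energy_tendsto_zero (hg : IsGraph b c) (hconn : Connected b) {o : X}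
    {ψ : ℕ → X → ℝ} (ho : ∀ n, ψ n o = 1)
    (hψ : Tendsto (fun n => energy b c (ψ n)) atTop (𝓝 0)) (x : X) :
    Tendsto (fun n => ψ n x) atTop (𝓝 1) := by
  induction hconn o x with
  | refl => simp [ho]
  | @tail u v _ huv ih =>
    have h2 : Tendsto (fun n => 2 * energy b c (ψ n)) atTop (𝓝 0) := by
      simpa using ENNReal.Tendsto.const_mul hψ (Or.inr ENNReal.ofNat_ne_top) (a := 2)
    have h3 := tendsto_zero_of_ofReal_le (fun n => mul_nonneg (hg.nonneg u v) (sq_nonneg _))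
      (fun n => edge_le_energy (b := b) (c := c) (ψ n) u v) h2
    have h4 : Tendsto (fun n => (ψ n u - ψ n v) ^ 2) atTop (𝓝 0) := by
      simpa [← mul_assoc, inv_mul_cancel₀ huv.ne'] using h3.const_mul (b u v)⁻¹
    have h5 : Tendsto (fun n => ψ n u - ψ n v) atTop (𝓝 0) := by
      rw [tendsto_zero_iff_abs_tendsto_zero]
      simpa [Function.comp_def, Real.sqrt_sq_eq_abs] using h4.sqrt
    simpa using ih.sub h5

/-- A connected graph carrying finitely supported functions of vanishing energy that are
normalized at one vertex is recurrent. -/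
theorem recurrent_of_energy_tendsto_zero (hg : IsGraph b c) (hconn : Connected b) {o : X}
    {ψ : ℕ → X → ℝ} (hfin : ∀ n, FinSupp (ψ n)) (ho : ∀ n, ψ n o = 1)
    (hψ : Tendsto (fun n => energy b c (ψ n)) atTop (𝓝 0)) :
    Recurrent b c := by
  have hone := tendsto_one_of_energy_tendsto_zero hg hconn ho hψ
  have hc : ∀ x, c x = 0 := fun x => by
    have h1 := tendsto_zero_of_ofReal_le (fun n => mul_nonneg (hg.c_nonneg x) (sq_nonneg _))
      (fun n => potential_le_energy (b := b) (c := c) (ψ n) x) hψ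
    have h2 := ((hone x).pow 2).const_mul (c x)
    simpa using tendsto_nhds_unique h2 h1
  refine ⟨⟨ψ, hfin, hone, ?_⟩, by simp [energy, hc]⟩
  have : ∀ n, energy b c (ψ n - 1) = energy b c (ψ n) := fun n => by simp [energy, hc]
  simpa only [this] using hψ

/-- In a transient connected graph every point evaluation is bounded on the finitely supported
functions with respect to the energy. -/
theorem Transient.exists_sq_le_mul_energy (ht : Transient b c) (hg : IsGraph b c)
    (hconn : Connected b) (o : X) :
    ∃ C : ℕ, ∀ φ : X → ℝ, FinSupp φ → ENNReal.ofReal (φ o ^ 2) ≤ C * energy b c φ := by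
  by_contra! h
  choose φ hfin hφ using h
  have hne : ∀ n, φ n o ≠ 0 := fun n h0 => by
    have := hφ n
    simp [h0] at this
  refine ht (recurrent_of_energy_tendsto_zero hg hconn (o := o)
    (ψ := fun n => (φ n o)⁻¹ • φ n) (fun n => ?_) (fun n => by simp [hne n]) ?_)
  · exact (hfin n).subset (Function.support_const_smul_subset _ _)
  · refine tendsto_of_tendsto_of_tendsto_of_le_of_le tendsto_const_nhds
      ENNReal.tendsto_inv_nat_nhds_zero (fun n => zero_le) fun n => ?_
    rw [ENNReal.le_inv_iff_mul_le]
    calc energy b c ((φ n o)⁻¹ • φ n) * n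
        = ENNReal.ofReal ((φ n o)⁻¹ ^ 2) * (n * energy b c (φ n)) := by
          rw [energy_smul]; ring
      _ ≤ ENNReal.ofReal ((φ n o)⁻¹ ^ 2) * ENNReal.ofReal (φ n o ^ 2) :=
          mul_le_mul_right (hφ n).le _
      _ = 1 := by
          rw [← ENNReal.ofReal_mul (sq_nonneg _), ← mul_pow, inv_mul_cancel₀ (hne n)]
          simp

/-- A graph whose point evaluations are uniformly bounded on the finitely supported functions
with respect to the energy is uniformly transient. -/
theorem uniformlyTransient_of_sq_le_mul_energy (hg : IsGraph b c) (C : ℕ)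
    (hC : ∀ x, ∀ φ : X → ℝ, FinSupp φ → ENNReal.ofReal (φ x ^ 2) ≤ C * energy b c φ) :
    UniformlyTransient b c := by
  rintro f ⟨φ, hfin, hpt, hen⟩ ε hε
  have hbound : ∀ n x, ENNReal.ofReal ((φ n x - f x) ^ 2)
      ≤ C * (2 * energy b c (φ n - f)) := by
    intro n x
    have hl : Tendsto (fun m => ENNReal.ofReal ((φ n x - φ m x) ^ 2)) atTop
        (𝓝 (ENNReal.ofReal ((φ n x - f x) ^ 2))) :=
      ENNReal.tendsto_ofReal (((hpt x).const_sub _).pow 2)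
    have hr : Tendsto (fun m => C * (2 * (energy b c (φ n - f) + energy b c (φ m - f)))) atTop
        (𝓝 (C * (2 * (energy b c (φ n - f) + 0)))) :=
      ENNReal.Tendsto.const_mul (ENNReal.Tendsto.const_mul (hen.const_add _)
        (Or.inr ENNReal.ofNat_ne_top)) (Or.inr (ENNReal.natCast_ne_top C))
    rw [add_zero] at hr
    refine le_of_tendsto_of_tendsto' hl hr fun m => ?_
    have h := hC x (φ n - φ m)
      (((hfin n).union (hfin m)).subset (Function.support_sub _ _))
    refine h.trans (mul_le_mul_right ?_ _)
    rw [← sub_sub_sub_cancel_right (φ n) (φ m) f]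
    exact energy_sub_le hg _ _
  have hlim : Tendsto (fun n => C * (2 * energy b c (φ n - f))) atTop (𝓝 0) := by
    simpa using ENNReal.Tendsto.const_mul (ENNReal.Tendsto.const_mul hen
      (Or.inr ENNReal.ofNat_ne_top) (a := 2)) (Or.inr (ENNReal.natCast_ne_top C)) (a := C)
  obtain ⟨n, hn⟩ := (hlim.eventually_lt_const
    (ENNReal.ofReal_pos.2 (by positivity : 0 < ε ^ 2))).exists
  refine (hfin n).subset fun x hx h0 => ?_
  have h1 := (hbound n x).trans_lt hn
  rw [h0, zero_sub, neg_sq, ← sq_abs, ENNReal.ofReal_lt_ofReal_iff (by positivity)] at h1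
  exact absurd hx (not_le.2 (lt_of_pow_lt_pow_left₀ 2 hε.le h1))

end Energy

end UTGraph

open UTGraph Filter Topology ENNReal in
/-- a connected, quasi-vertex-transitive, transient graph is
uniformly transient. -/
theorem stmt10 {X : Type*} [Countable X] [Infinite X]
    (b : X → X → ℝ) (c : X → ℝ) (hgraph : IsGraph b c) (hconn : Connected b)
    (hqt : ∃ (n : ℕ) (xs : Fin n → X), ∀ y : X, ∃ (j : Fin n) (h : X → X),
      Function.Bijective h ∧ h y = xs j ∧ (∀ z, c (h z) = c z) ∧
      ∀ v w, b (h v) (h w) = b v w)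
    (ht : Transient b c) :
    UniformlyTransient b c := by
  obtain ⟨n, xs, hxs⟩ := hqt
  choose C hC using fun j => ht.exists_sq_le_mul_energy hgraph hconn (xs j)
  refine uniformlyTransient_of_sq_le_mul_energy hgraph (∑ j, C j) fun y φ hφ => ?_
  obtain ⟨j, h, hbij, hy, hc, hb⟩ := hxs y
  let e : X ≃ X := Equiv.ofBijective h hbij
  have hcomp : (φ ∘ e.symm) ∘ e = φ := by
    funext z
    simp
  have hfin : FinSupp (φ ∘ e.symm) := by
    unfold FinSupp
    rw [Function.support_comp_eq_preimage]
    exact hφ.preimage e.symm.injective.injOn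
  have hey : e.symm (xs j) = y := by
    rw [← hy]
    exact e.symm_apply_apply y
  have hj := hC j (φ ∘ e.symm) hfin
  rw [← energy_comp_equiv e hc hb, hcomp, Function.comp_apply, hey] at hj
  refine hj.trans (mul_le_mul_left ?_ _)
  exact_mod_cast Finset.single_le_sum (fun i _ => Nat.zero_le (C i)) (Finset.mem_univ j)
end
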